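/- arXiv:0906.3162 — 7 statements merged into one kernel-verified Lean document; each statement's English description precedes it below -/
import Mathlib

section
/- Let n ≥ 2, let γ ≥ 1, and let W be a γ-stable Max-Cut instance on Fin n with maximal cut S such that S ≠ ∅ and S ≠ Finset.univ. Then W is γ-locally stable with respect to S; that is, for every v ∈ S, γ * ∑_{u ∈ S} W u v < ∑_{u ∉ S} W u v, and for every v ∉ S, γ * ∑_{u ∉ S} W u v < ∑_{u ∈ S} W u v. -/
open Finset Matrix

/-- Cut weight of `S`: sum of `W i j` over `i ∈ S`, `j ∉ S`. -/
def cutWeight {n : ℕ} (W : Matrix (Fin n) (Fin n) ℝ) (S : Finset (Fin n)) : ℝ :=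
  ∑ i ∈ S, ∑ j ∈ Sᶜ, W i j

/-- `S` is a maximal cut of `W`. -/
def IsMaxCut {n : ℕ} (W : Matrix (Fin n) (Fin n) ℝ) (S : Finset (Fin n)) : Prop :=
  ∀ T : Finset (Fin n), cutWeight W T ≤ cutWeight W S

/-- `W'` is a `γ`-perturbation of `W`. -/
def IsPerturbation {n : ℕ} (γ : ℝ) (W W' : Matrix (Fin n) (Fin n) ℝ) : Prop :=
  W'.IsSymm ∧ ∀ i j, W i j ≤ W' i j ∧ W' i j ≤ γ * W i j

theorem cutWeight_compl {n : ℕ} {W : Matrix (Fin n) (Fin n) ℝ} (hW : W.IsSymm)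
    (S : Finset (Fin n)) : cutWeight W Sᶜ = cutWeight W S := by
  unfold cutWeight
  rw [compl_compl]
  refine Finset.sum_comm.trans ?_
  exact Finset.sum_congr rfl fun i _ => Finset.sum_congr rfl fun j _ => hW.apply i j

/-- Moving a vertex `v` out of `S` loses its edges to `Sᶜ` and gains its edges to `S`. -/
theorem cutWeight_erase {n : ℕ} {W : Matrix (Fin n) (Fin n) ℝ} (hW : W.IsSymm)
    {S : Finset (Fin n)} {v : Fin n} (hv : v ∈ S) (hvv : W v v = 0) :
    cutWeight W (S.erase v) + ∑ u ∈ Sᶜ, W u v = cutWeight W S + ∑ u ∈ S, W u v := by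
  have hrow : ∑ u ∈ Sᶜ, W u v = ∑ u ∈ Sᶜ, W v u :=
    Finset.sum_congr rfl fun u _ => hW.apply v u
  have hins : ∀ i, ∑ j ∈ insert v Sᶜ, W i j = W i v + ∑ j ∈ Sᶜ, W i j :=
    fun i => Finset.sum_insert (by simpa using hv)
  unfold cutWeight
  rw [Finset.compl_erase, Finset.sum_congr rfl fun i _ => hins i, Finset.sum_add_distrib, hrow,
    ← Finset.add_sum_erase S (fun i => ∑ j ∈ Sᶜ, W i j) hv,
    ← Finset.add_sum_erase S (fun u => W u v) hv, hvv]
  ring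

/-- The perturbation scaling by `γ` exactly the edges that do not cross the cut `S`. -/
def scaleUncut {n : ℕ} (γ : ℝ) (W : Matrix (Fin n) (Fin n) ℝ) (S : Finset (Fin n)) :
    Matrix (Fin n) (Fin n) ℝ :=
  Matrix.of fun i j => if i ∈ S ↔ j ∈ S then γ * W i j else W i j

theorem isPerturbation_scaleUncut {n : ℕ} {γ : ℝ} (hγ : 1 ≤ γ) {W : Matrix (Fin n) (Fin n) ℝ}
    (hW : W.IsSymm) (hnonneg : ∀ i j, 0 ≤ W i j) (S : Finset (Fin n)) :
    IsPerturbation γ W (scaleUncut γ W S) := by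
  refine ⟨Matrix.IsSymm.ext fun i j => ?_, fun i j => ?_⟩
  · simp only [scaleUncut, Matrix.of_apply, hW.apply i j, iff_comm (a := j ∈ S)]
  · have h := le_mul_of_one_le_left (hnonneg i j) hγ
    simp only [scaleUncut, Matrix.of_apply]
    split_ifs <;> exact ⟨by linarith, by linarith⟩

theorem mul_sum_lt_of_stable {n : ℕ} {γ : ℝ} (hγ : 1 ≤ γ) {W : Matrix (Fin n) (Fin n) ℝ}
    (hW : W.IsSymm) (hnonneg : ∀ i j, 0 ≤ W i j) (hdiag : ∀ i, W i i = 0)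
    {S : Finset (Fin n)}
    (hstab : ∀ W', IsPerturbation γ W W' →
      ∀ T : Finset (Fin n), cutWeight W' S ≤ cutWeight W' T → T = S ∨ T = Sᶜ)
    (hSuniv : S ≠ Finset.univ) {v : Fin n} (hv : v ∈ S) :
    γ * ∑ u ∈ S, W u v < ∑ u ∈ Sᶜ, W u v := by
  by_contra! hle
  have hpert := isPerturbation_scaleUncut hγ hW hnonneg S
  have hin : ∑ u ∈ S, scaleUncut γ W S u v = γ * ∑ u ∈ S, W u v := by
    rw [Finset.mul_sum]
    exact Finset.sum_congr rfl fun u hu => by simp [scaleUncut, hu, hv]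
  have hout : ∑ u ∈ Sᶜ, scaleUncut γ W S u v = ∑ u ∈ Sᶜ, W u v :=
    Finset.sum_congr rfl fun u hu => by simp [scaleUncut, Finset.mem_compl.mp hu, hv]
  have herase := cutWeight_erase hpert.1 hv (by simp [scaleUncut, hdiag])
  rw [hin, hout] at herase
  rcases hstab _ hpert (S.erase v) (by linarith) with h | h
  · exact Finset.notMem_erase v S (h.symm ▸ hv)
  · refine hSuniv (Finset.eq_univ_of_forall fun u => ?_)
    by_contra hu
    exact hu (Finset.mem_of_mem_erase (h.symm ▸ Finset.mem_compl.mpr hu))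

theorem statement4 {n : ℕ} (hn : 2 ≤ n) (γ : ℝ) (hγ : 1 ≤ γ)
    (W : Matrix (Fin n) (Fin n) ℝ)
    (hsymm : W.IsSymm) (hnonneg : ∀ i j, 0 ≤ W i j) (hdiag : ∀ i, W i i = 0)
    (S : Finset (Fin n)) (hmax : IsMaxCut W S)
    (hstab : ∀ W', IsPerturbation γ W W' →
      ∀ T : Finset (Fin n), cutWeight W' S ≤ cutWeight W' T → T = S ∨ T = Sᶜ)
    (hS0 : S ≠ ∅) (hSuniv : S ≠ Finset.univ) :
    (∀ v ∈ S, γ * ∑ u ∈ S, W u v < ∑ u ∈ Sᶜ, W u v) ∧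
    (∀ v ∉ S, γ * ∑ u ∈ Sᶜ, W u v < ∑ u ∈ S, W u v) := by
  refine ⟨fun v hv => mul_sum_lt_of_stable hγ hsymm hnonneg hdiag hstab hSuniv hv,
    fun v hv => ?_⟩
  have hstab' : ∀ W', IsPerturbation γ W W' →
      ∀ T : Finset (Fin n), cutWeight W' Sᶜ ≤ cutWeight W' T → T = Sᶜ ∨ T = Sᶜᶜ := by
    intro W' hW' T hT
    rw [cutWeight_compl hW'.1] at hT
    rw [compl_compl]
    exact (hstab W' hW' T hT).symm
  have hlt := mul_sum_lt_of_stable hγ hsymm hnonneg hdiag hstab'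
    (by rwa [Ne, Finset.compl_eq_univ_iff]) (Finset.mem_compl.mpr hv)
  rwa [compl_compl] at hlt
end

section
/- Let W be a γ-stable Max-Cut instance on Fin n with maximal cut S, and let Δ = max_i |{j : W i j > 0}| be the maximal degree of its support. Assume γ > Real.sqrt (n * Δ). Let C : Fin t → Finset (Fin n) (t ≥ 2) be a partition of Fin n into pairwise disjoint nonempty sets covering Fin n, and for each l let (L l, R l) be a partition of C l such that either L l ⊆ S and R l ⊆ Sᶜ, or R l ⊆ S and L l ⊆ Sᶜ. For disjoint A, B let w(A,B) = ∑_{a ∈ A} ∑_{b ∈ B} W a b. Let i* be an index with |C i*| minimal, and for j ≠ i* set e j 0 = w(L i*, L j) + w(R i*, R j) and e j 1 = w(L i*, R j) + w(R i*, L j). Suppose j* ≠ i* and c* ∈ {0,1} maximize e j c over all j ≠ i* and c ∈ {0,1}. Then every pair (u, v) with W u v > 0 that contributes to e j* c* (i.e., u ∈ L i* ∧ v ∈ L j*, or u ∈ R i* ∧ v ∈ R j* when c* = 0; u ∈ L i* ∧ v ∈ R j*, or u ∈ R i* ∧ v ∈ L j* when c* = 1) is cut by S, i.e., exactly one of u,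 v lies in S. -/
open Finset Matrix

/-- `w(A,B)`: total weight of edges between disjoint sets `A` and `B`. -/
def wAB {n : ℕ} (W : Matrix (Fin n) (Fin n) ℝ) (A B : Finset (Fin n)) : ℝ :=
  ∑ a ∈ A, ∑ b ∈ B, W a b

/-- The part of `W` lying on the pairs not separated by `S`. -/
def samePart {n : ℕ} (W : Matrix (Fin n) (Fin n) ℝ) (S : Finset (Fin n)) :
    Matrix (Fin n) (Fin n) ℝ :=
  fun i j => if (i ∈ S ↔ j ∈ S) then W i j else 0

/-- The part of `W` lying on the pairs separated by `S`. -/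
def crossPart {n : ℕ} (W : Matrix (Fin n) (Fin n) ℝ) (S : Finset (Fin n)) :
    Matrix (Fin n) (Fin n) ℝ :=
  fun i j => if (i ∈ S ↔ j ∈ S) then 0 else W i j

section

variable {n : ℕ} {W : Matrix (Fin n) (Fin n) ℝ} {S : Finset (Fin n)}

theorem samePart_nonneg (hW : ∀ i j, 0 ≤ W i j) (i j : Fin n) : 0 ≤ samePart W S i j := by
  unfold samePart
  split_ifs
  · exact hW i j
  · exact le_rfl

theorem samePart_symm (hW : ∀ i j, W i j = W j i) (i j : Fin n) :
    samePart W S i j = samePart W S j i := by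
  simp only [samePart, hW i j, iff_comm (a := i ∈ S)]

theorem crossPart_symm (hW : ∀ i j, W i j = W j i) (i j : Fin n) :
    crossPart W S i j = crossPart W S j i := by
  simp only [crossPart, hW i j, iff_comm (a := i ∈ S)]

theorem two_mul_cutWeight (hW : ∀ i j, W i j = W j i) (S : Finset (Fin n)) :
    2 * cutWeight W S = ∑ i, ∑ j, crossPart W S i j := by
  have h1 : cutWeight W S = ∑ i, ∑ j, if i ∈ S ∧ j ∉ S then W i j else 0 := by
    simp only [ite_and, ← Finset.mem_compl, Finset.sum_ite_irrel, Finset.sum_const_zero,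
      Finset.sum_ite_mem, Finset.univ_inter, cutWeight]
  have h2 : cutWeight W S = ∑ i, ∑ j, if j ∈ S ∧ i ∉ S then W i j else 0 := by
    rw [h1, Finset.sum_comm]
    refine Finset.sum_congr rfl fun i _ => Finset.sum_congr rfl fun j _ => ?_
    rw [hW]
  rw [two_mul]
  nth_rewrite 1 [h1]
  rw [h2, ← Finset.sum_add_distrib]
  refine Finset.sum_congr rfl fun i _ => ?_
  rw [← Finset.sum_add_distrib]
  refine Finset.sum_congr rfl fun j _ => ?_
  unfold crossPart
  by_cases hi : i ∈ S <;> by_cases hj : j ∈ S <;> simp [hi, hj]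

theorem cutWeight_symmDiff (hW : ∀ i j, W i j = W j i) (S A : Finset (Fin n)) :
    cutWeight W (symmDiff S A) =
      cutWeight W S + wAB (samePart W S) A Aᶜ - wAB (crossPart W S) A Aᶜ := by
  have h1 := two_mul_cutWeight hW S
  have h2 := two_mul_cutWeight hW (symmDiff S A)
  have h3 : 2 * wAB (samePart W S) A Aᶜ = _ := two_mul_cutWeight (samePart_symm hW) A
  have h4 : 2 * wAB (crossPart W S) A Aᶜ = _ := two_mul_cutWeight (crossPart_symm hW) A
  have h5 : ∑ i, ∑ j, crossPart W (symmDiff S A) i j =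
      ∑ i, ∑ j, crossPart W S i j + ∑ i, ∑ j, crossPart (samePart W S) A i j
        - ∑ i, ∑ j, crossPart (crossPart W S) A i j := by
    simp only [← Finset.sum_add_distrib, ← Finset.sum_sub_distrib]
    refine Finset.sum_congr rfl fun i _ => Finset.sum_congr rfl fun j _ => ?_
    unfold crossPart samePart
    by_cases hi : i ∈ S <;> by_cases hj : j ∈ S <;> by_cases hi' : i ∈ A <;>
      by_cases hj' : j ∈ A <;> simp [hi, hj, hi', hj', Finset.mem_symmDiff]
  linarith

theorem mul_samePart_lt_crossPart_of_stable {γ : ℝ} (hγ : 1 ≤ γ) (hsymm : W.IsSymm)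
    (hW : ∀ i j, 0 ≤ W i j)
    (hstab : ∀ W', IsPerturbation γ W W' →
      ∀ T : Finset (Fin n), cutWeight W' S ≤ cutWeight W' T → T = S ∨ T = Sᶜ)
    {A : Finset (Fin n)} (hA : A.Nonempty) (hA' : A ≠ univ) :
    γ * wAB (samePart W S) A Aᶜ < wAB (crossPart W S) A Aᶜ := by
  by_contra! hle
  have hs : ∀ i j, W i j = W j i := fun i j => hsymm.apply j i
  let W' : Matrix (Fin n) (Fin n) ℝ := fun i j => if (i ∈ S ↔ j ∈ S) then γ * W i j else W i j
  have hs' : ∀ i j, W' i j = W' j i := fun i j => by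
    simp only [W', hs i j, iff_comm (a := i ∈ S)]
  have hpert : IsPerturbation γ W W' := by
    refine ⟨Matrix.IsSymm.ext fun i j => hs' j i, fun i j => ?_⟩
    have := le_mul_of_one_le_left (hW i j) hγ
    simp only [W']
    split_ifs
    · exact ⟨this, le_rfl⟩
    · exact ⟨le_rfl, this⟩
  have hsame : wAB (samePart W' S) A Aᶜ = γ * wAB (samePart W S) A Aᶜ := by
    simp only [wAB, Finset.mul_sum]
    refine Finset.sum_congr rfl fun i _ => Finset.sum_congr rfl fun j _ => ?_
    simp only [samePart, W']
    split_ifs <;> simp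
  have hcross : wAB (crossPart W' S) A Aᶜ = wAB (crossPart W S) A Aᶜ := by
    refine Finset.sum_congr rfl fun i _ => Finset.sum_congr rfl fun j _ => ?_
    simp only [crossPart, W']
    split_ifs <;> rfl
  have hcut := cutWeight_symmDiff hs' S A
  rcases hstab W' hpert (symmDiff S A) (by linarith) with h | h
  · exact hA.ne_empty (symmDiff_eq_left.1 h)
  · apply hA'
    exact symmDiff_right_injective S (h.trans (symmDiff_top S).symm)

theorem wAB_union_union (M : Matrix (Fin n) (Fin n) ℝ) {L R L' R' : Finset (Fin n)}
    (h : Disjoint L R) (h' : Disjoint L' R') :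
    wAB M (L ∪ R) (L' ∪ R') = wAB M L L' + wAB M L R' + wAB M R L' + wAB M R R' := by
  simp only [wAB, Finset.sum_union h, Finset.sum_union h', Finset.sum_add_distrib]
  ring

theorem wAB_samePart_of_iff {A B : Finset (Fin n)} (h : ∀ a ∈ A, ∀ b ∈ B, (a ∈ S ↔ b ∈ S)) :
    wAB (samePart W S) A B = wAB W A B ∧ wAB (crossPart W S) A B = 0 :=
  ⟨Finset.sum_congr rfl fun a ha => Finset.sum_congr rfl fun b hb => if_pos (h a ha b hb),
    Finset.sum_eq_zero fun a ha => Finset.sum_eq_zero fun b hb => if_pos (h a ha b hb)⟩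

theorem wAB_crossPart_of_not_iff {A B : Finset (Fin n)}
    (h : ∀ a ∈ A, ∀ b ∈ B, ¬ (a ∈ S ↔ b ∈ S)) :
    wAB (samePart W S) A B = 0 ∧ wAB (crossPart W S) A B = wAB W A B :=
  ⟨Finset.sum_eq_zero fun a ha => Finset.sum_eq_zero fun b hb => if_neg (h a ha b hb),
    Finset.sum_congr rfl fun a ha => Finset.sum_congr rfl fun b hb => if_neg (h a ha b hb)⟩

theorem wAB_parts_of_aligned {L R L' R' : Finset (Fin n)} (h : Disjoint L R) (h' : Disjoint L' R')
    (hs : (L ⊆ S ∧ R ⊆ Sᶜ ∧ L' ⊆ S ∧ R' ⊆ Sᶜ) ∨ (R ⊆ S ∧ L ⊆ Sᶜ ∧ R' ⊆ S ∧ L' ⊆ Sᶜ)) :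
    wAB (samePart W S) (L ∪ R) (L' ∪ R') = wAB W L L' + wAB W R R' ∧
      wAB (crossPart W S) (L ∪ R) (L' ∪ R') = wAB W L R' + wAB W R L' := by
  simp only [Finset.subset_iff, Finset.mem_compl] at hs
  have h1 := wAB_samePart_of_iff (W := W) (S := S) (A := L) (B := L') (by grind)
  have h2 := wAB_samePart_of_iff (W := W) (S := S) (A := R) (B := R') (by grind)
  have h3 := wAB_crossPart_of_not_iff (W := W) (S := S) (A := L) (B := R') (by grind)
  have h4 := wAB_crossPart_of_not_iff (W := W) (S := S) (A := R) (B := L') (by grind)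
  simp only [wAB_union_union _ h h', h1, h2, h3, h4]
  constructor <;> ring

theorem wAB_parts_of_opposed {L R L' R' : Finset (Fin n)} (h : Disjoint L R) (h' : Disjoint L' R')
    (hs : (L ⊆ S ∧ R ⊆ Sᶜ ∧ R' ⊆ S ∧ L' ⊆ Sᶜ) ∨ (R ⊆ S ∧ L ⊆ Sᶜ ∧ L' ⊆ S ∧ R' ⊆ Sᶜ)) :
    wAB (samePart W S) (L ∪ R) (L' ∪ R') = wAB W L R' + wAB W R L' ∧
      wAB (crossPart W S) (L ∪ R) (L' ∪ R') = wAB W L L' + wAB W R R' := by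
  rw [Finset.union_comm L' R']
  refine wAB_parts_of_aligned h h'.symm ?_
  tauto

theorem wAB_pos (hW : ∀ i j, 0 ≤ W i j) {A B : Finset (Fin n)} {u v : Fin n} (hu : u ∈ A)
    (hv : v ∈ B) (huv : 0 < W u v) : 0 < wAB W A B :=
  Finset.sum_pos' (fun _ _ => Finset.sum_nonneg fun _ _ => hW _ _)
    ⟨u, hu, Finset.sum_pos' (fun _ _ => hW _ _) ⟨v, hv, huv⟩⟩

theorem wAB_mono_right (hW : ∀ i j, 0 ≤ W i j) {A B B' : Finset (Fin n)} (h : B ⊆ B') :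
    wAB W A B ≤ wAB W A B' :=
  Finset.sum_le_sum fun _ _ => Finset.sum_le_sum_of_subset_of_nonneg h fun _ _ _ => hW _ _

theorem wAB_biUnion {ι : Type*} (M : Matrix (Fin n) (Fin n) ℝ) (A : Finset (Fin n)) (s : Finset ι)
    {C : ι → Finset (Fin n)} (hC : (s : Set ι).PairwiseDisjoint C) :
    wAB M A (s.biUnion C) = ∑ l ∈ s, wAB M A (C l) := by
  simp only [wAB, Finset.sum_biUnion hC]
  exact Finset.sum_comm

/-- If the total cross weight between the smallest part and any other part is at most `x`, then the
whole cross weight leaving it is at most `√(n Δ) x`. -/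
theorem wAB_crossPart_compl_le {t Δ : ℕ} (hW : ∀ i j, 0 ≤ W i j)
    (hΔ : ∀ i, (univ.filter fun j => 0 < W i j).card ≤ Δ) {C : Fin t → Finset (Fin n)}
    (hdisj : ∀ l m, l ≠ m → Disjoint (C l) (C m)) (hcover : ∀ v, ∃ l, v ∈ C l)
    {k : Fin t} (hmin : ∀ l, (C k).card ≤ (C l).card) {x : ℝ} (hx : 0 ≤ x)
    (hle : ∀ l, l ≠ k → wAB (crossPart W S) (C k) (C l) ≤ x) :
    wAB (crossPart W S) (C k) (C k)ᶜ ≤ √(n * Δ) * x := by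
  choose f hf using hcover
  have hpd : ∀ s : Finset (Fin t), (s : Set (Fin t)).PairwiseDisjoint C :=
    fun s l _ m _ h => hdisj l m h
  have huniq : ∀ v l, v ∈ C l → f v = l := fun v l hv => by
    by_contra h
    exact Finset.disjoint_left.1 (hdisj _ _ h) (hf v) hv
  have hcompl : (C k)ᶜ = (univ.erase k).biUnion C := by
    ext v
    simp only [Finset.mem_compl, Finset.mem_biUnion, Finset.mem_erase, Finset.mem_univ, and_true]
    refine ⟨fun hv => ⟨f v, fun h => hv (h ▸ hf v), hf v⟩, ?_⟩
    rintro ⟨l, hl, hv⟩ hk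
    exact hl ((huniq v l hv).symm.trans (huniq v k hk))
  set J := (univ.erase k).filter fun l => wAB (crossPart W S) (C k) (C l) ≠ 0 with hJ
  have hsum : wAB (crossPart W S) (C k) (C k)ᶜ ≤ J.card * x := by
    rw [hcompl, wAB_biUnion _ _ _ (hpd _), ← Finset.sum_filter_ne_zero, ← nsmul_eq_mul]
    exact Finset.sum_le_card_nsmul _ _ _ fun l hl =>
      hle l (Finset.ne_of_mem_erase (Finset.mem_filter.1 hl).1)
  have hJt : J.card ≤ t := (Finset.card_le_univ J).trans_eq (Fintype.card_fin t)
  have hJΔ : J.card ≤ (C k).card * Δ := by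
    have hsub : J ⊆ (C k).biUnion fun a => (univ.filter fun j => 0 < W a j).image f := by
      intro l hl
      obtain ⟨a, ha, h1⟩ := Finset.exists_ne_zero_of_sum_ne_zero (Finset.mem_filter.1 hl).2
      obtain ⟨b, hb, h2⟩ := Finset.exists_ne_zero_of_sum_ne_zero h1
      have hab : 0 < W a b := by
        refine (hW a b).lt_of_ne fun h => h2 ?_
        simp [crossPart, ← h]
      simp only [Finset.mem_biUnion, Finset.mem_image, Finset.mem_filter, Finset.mem_univ,
        true_and]
      exact ⟨a, ha, b, hab, huniq b l hb⟩
    exact (Finset.card_le_card hsub).trans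
      (Finset.card_biUnion_le_card_mul _ _ _ fun a _ => Finset.card_image_le.trans (hΔ a))
  have htn : t * (C k).card ≤ n := by
    calc t * (C k).card = ∑ _l : Fin t, (C k).card := by simp
      _ ≤ ∑ l, (C l).card := Finset.sum_le_sum fun l _ => hmin l
      _ = (univ.biUnion C).card := (Finset.card_biUnion fun l _ m _ h => hdisj l m h).symm
      _ ≤ n := (Finset.card_le_univ _).trans_eq (Fintype.card_fin n)
  have hsq : J.card * J.card ≤ n * Δ :=
    calc J.card * J.card ≤ t * ((C k).card * Δ) := Nat.mul_le_mul hJt hJΔ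
      _ = t * (C k).card * Δ := (mul_assoc _ _ _).symm
      _ ≤ n * Δ := Nat.mul_le_mul_right _ htn
  refine hsum.trans (mul_le_mul_of_nonneg_right (Real.le_sqrt_of_sq_le ?_) hx)
  rw [sq]
  exact_mod_cast hsq

end

theorem statement8 {n t : ℕ}
    (W : Matrix (Fin n) (Fin n) ℝ)
    (hsymm : W.IsSymm) (hnonneg : ∀ i j, 0 ≤ W i j) (hdiag : ∀ i, W i i = 0)
    (γ : ℝ) (S : Finset (Fin n)) (hmax : IsMaxCut W S)
    (hstab : ∀ W', IsPerturbation γ W W' →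
      ∀ T : Finset (Fin n), cutWeight W' S ≤ cutWeight W' T → T = S ∨ T = Sᶜ)
    (Δ : ℕ)
    (hΔ : Δ = Finset.univ.sup fun i => (Finset.univ.filter fun j => 0 < W i j).card)
    (hγ : Real.sqrt (n * Δ) < γ)
    (ht : 2 ≤ t) (C L R : Fin t → Finset (Fin n))
    (hdisj : ∀ l m, l ≠ m → Disjoint (C l) (C m))
    (hne : ∀ l, (C l).Nonempty)
    (hcover : ∀ v : Fin n, ∃ l, v ∈ C l)
    (hLR : ∀ l, Disjoint (L l) (R l) ∧ L l ∪ R l = C l)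
    (hsep : ∀ l, (L l ⊆ S ∧ R l ⊆ Sᶜ) ∨ (R l ⊆ S ∧ L l ⊆ Sᶜ))
    (istar : Fin t) (hmin : ∀ l, (C istar).card ≤ (C l).card)
    (e : Fin t → Bool → ℝ)
    (he0 : ∀ l, e l false = wAB W (L istar) (L l) + wAB W (R istar) (R l))
    (he1 : ∀ l, e l true = wAB W (L istar) (R l) + wAB W (R istar) (L l))
    (jstar : Fin t) (cstar : Bool) (hjstar : jstar ≠ istar)
    (hbest : ∀ l, l ≠ istar → ∀ c : Bool, e l c ≤ e jstar cstar)
    (u v : Fin n) (huv : 0 < W u v)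
    (hcontrib :
      if cstar then (u ∈ L istar ∧ v ∈ R jstar) ∨ (u ∈ R istar ∧ v ∈ L jstar)
      else (u ∈ L istar ∧ v ∈ L jstar) ∨ (u ∈ R istar ∧ v ∈ R jstar)) :
    Xor' (u ∈ S) (v ∈ S) := by
  have hdeg : ∀ i, (univ.filter fun j => 0 < W i j).card ≤ Δ := fun i => by
    rw [hΔ]
    exact Finset.le_sup (f := fun i => (univ.filter fun j => 0 < W i j).card) (Finset.mem_univ i)
  have hγ1 : 1 ≤ γ := by
    have hn : 1 ≤ n := Nat.one_le_of_lt u.isLt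
    have hΔ1 : 1 ≤ Δ :=
      (Finset.card_pos.2 ⟨v, Finset.mem_filter.2 ⟨Finset.mem_univ v, huv⟩⟩).trans_le (hdeg u)
    refine le_trans (Real.one_le_sqrt.2 ?_) hγ.le
    exact_mod_cast Nat.mul_le_mul hn hΔ1
  have hparts : ∀ l, ∃ c, wAB (crossPart W S) (C istar) (C l) = e l c ∧
      wAB (samePart W S) (C istar) (C l) = e l (!c) := fun l => by
    rw [← (hLR istar).2, ← (hLR l).2]
    rcases hsep istar with hi | hi <;> rcases hsep l with hl | hl
    · obtain ⟨h1, h2⟩ := wAB_parts_of_aligned (W := W) (S := S) (hLR istar).1 (hLR l).1 (by tauto)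
      exact ⟨true, by rw [h2, he1], by rw [h1, Bool.not_true, he0]⟩
    · obtain ⟨h1, h2⟩ := wAB_parts_of_opposed (W := W) (S := S) (hLR istar).1 (hLR l).1 (by tauto)
      exact ⟨false, by rw [h2, he0], by rw [h1, Bool.not_false, he1]⟩
    · obtain ⟨h1, h2⟩ := wAB_parts_of_opposed (W := W) (S := S) (hLR istar).1 (hLR l).1 (by tauto)
      exact ⟨false, by rw [h2, he0], by rw [h1, Bool.not_false, he1]⟩
    · obtain ⟨h1, h2⟩ := wAB_parts_of_aligned (W := W) (S := S) (hLR istar).1 (hLR l).1 (by tauto)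
      exact ⟨true, by rw [h2, he1], by rw [h1, Bool.not_true, he0]⟩
  by_contra hxor
  have hsame : u ∈ S ↔ v ∈ S := by
    by_contra h
    exact hxor (xor_iff_not_iff _ _ |>.2 h)
  have hbound : e jstar cstar ≤ wAB (samePart W S) (C istar) (C jstar) := by
    have hi := hLR istar
    have hj := hLR jstar
    have hsi := hsep istar
    have hsj := hsep jstar
    simp only [Finset.subset_iff, Finset.mem_compl] at hsi hsj
    rw [← hi.2, ← hj.2]
    cases cstar
    · have h := wAB_parts_of_aligned (W := W) (S := S) hi.1 hj.1 (by
        simp only [Finset.subset_iff, Finset.mem_compl]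
        grind)
      rw [h.1, he0]
    · have h := wAB_parts_of_opposed (W := W) (S := S) hi.1 hj.1 (by
        simp only [Finset.subset_iff, Finset.mem_compl]
        grind)
      rw [h.1, he1]
  have hmem : u ∈ C istar ∧ v ∈ C jstar := by
    rw [← (hLR istar).2, ← (hLR jstar).2]
    grind
  have hsub : C jstar ⊆ (C istar)ᶜ := fun w hw =>
    Finset.mem_compl.2 fun hw' => Finset.disjoint_left.1 (hdisj _ _ hjstar) hw hw'
  have hpos : 0 < e jstar cstar := by
    have h : 0 < wAB (samePart W S) (C istar) (C jstar) :=
      wAB_pos (samePart_nonneg hnonneg) hmem.1 hmem.2 (by simpa [samePart, hsame] using huv)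
    obtain ⟨c, -, hc⟩ := hparts jstar
    exact (hc ▸ h).trans_le (hbest jstar hjstar _)
  have hupper : wAB (crossPart W S) (C istar) (C istar)ᶜ ≤ √(n * Δ) * e jstar cstar :=
    wAB_crossPart_compl_le hnonneg hdeg hdisj hcover hmin hpos.le fun l hl => by
      obtain ⟨c, hc, -⟩ := hparts l
      exact hc ▸ hbest l hl c
  have hlower := mul_samePart_lt_crossPart_of_stable hγ1 hsymm hnonneg hstab (hne istar)
    fun h => Finset.notMem_empty v (by simpa [h] using hsub hmem.2)
  have hmono : e jstar cstar ≤ wAB (samePart W S) (C istar) (C istar)ᶜ :=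
    hbound.trans (wAB_mono_right (samePart_nonneg hnonneg) hsub)
  have h1 := mul_le_mul_of_nonneg_left hmono (zero_le_one.trans hγ1)
  have h2 := mul_lt_mul_of_pos_right hγ hpos
  linarith
end

section
/- Let G be a simple graph on Fin n whose {0,1} adjacency matrix is γ-locally stable with respect to a maximal cut S, for some γ ≥ 1. If two vertices i and j satisfy |N(i) ∩ N(j)| ≥ (deg i + deg j)/(γ + 1), where N(v) is the neighborhood of v and deg v its degree, then i and j lie on the same side of the maximal cut: i ∈ S ↔ j ∈ S. -/
open Finset Matrix

/-- `W` with maximal cut `S` is `γ`-locally stable. -/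
def IsLocallyStable {n : ℕ} (γ : ℝ) (W : Matrix (Fin n) (Fin n) ℝ) (S : Finset (Fin n)) : Prop :=
  (∀ v ∈ S, γ * ∑ u ∈ S, W u v < ∑ u ∈ Sᶜ, W u v) ∧
  (∀ v ∈ Sᶜ, γ * ∑ u ∈ Sᶜ, W u v < ∑ u ∈ S, W u v)

theorem sum_adjMatrix_eq_card_inter {V : Type*} [Fintype V] [DecidableEq V] (G : SimpleGraph V)
    [DecidableRel G.Adj] (T : Finset V) (v : V) :
    ∑ u ∈ T, G.adjMatrix ℝ u v = ((G.neighborFinset v ∩ T).card : ℝ) := by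
  simp only [SimpleGraph.adjMatrix_apply, Finset.sum_boole]
  congr 2
  ext u
  simp [G.adj_comm, and_comm]

theorem card_inter_add_card_inter_compl {V : Type*} [Fintype V] [DecidableEq V]
    (A T : Finset V) : (A ∩ T).card + (A ∩ Tᶜ).card = A.card := by
  rw [← Finset.sdiff_eq_inter_compl, Finset.card_inter_add_card_sdiff]

theorem IsLocallyStable.card_common_neighbors_lt {n : ℕ} {G : SimpleGraph (Fin n)}
    [DecidableRel G.Adj] {γ : ℝ} (hγ : 0 < γ + 1) {S : Finset (Fin n)}
    (hloc : IsLocallyStable γ (G.adjMatrix ℝ) S) {i j : Fin n} (hi : i ∈ S) (hj : j ∉ S) :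
    ((G.neighborFinset i ∩ G.neighborFinset j).card : ℝ) <
      ((G.degree i + G.degree j : ℕ) : ℝ) / (γ + 1) := by
  have h₁ := hloc.1 i hi
  have h₂ := hloc.2 j (Finset.mem_compl.2 hj)
  simp only [sum_adjMatrix_eq_card_inter] at h₁ h₂
  have hdi : ((G.neighborFinset i ∩ S).card : ℝ) + (G.neighborFinset i ∩ Sᶜ).card =
      G.degree i := mod_cast card_inter_add_card_inter_compl (G.neighborFinset i) S
  have hdj : ((G.neighborFinset j ∩ S).card : ℝ) + (G.neighborFinset j ∩ Sᶜ).card =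
      G.degree j := mod_cast card_inter_add_card_inter_compl (G.neighborFinset j) S
  have hc : ((G.neighborFinset i ∩ G.neighborFinset j).card : ℝ) ≤
      (G.neighborFinset i ∩ S).card + (G.neighborFinset j ∩ Sᶜ).card := by
    rw [← card_inter_add_card_inter_compl _ S, Nat.cast_add]
    gcongr
    · exact Finset.inter_subset_left
    · exact Finset.inter_subset_right
  have hm := mul_le_mul_of_nonneg_right hc hγ.le
  rw [lt_div_iff₀ hγ, Nat.cast_add]
  linarith

theorem statement9 {n : ℕ} (G : SimpleGraph (Fin n)) [DecidableRel G.Adj]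
    (γ : ℝ) (hγ : 1 ≤ γ) (S : Finset (Fin n))
    (hmax : IsMaxCut (G.adjMatrix ℝ) S)
    (hloc : IsLocallyStable γ (G.adjMatrix ℝ) S)
    (i j : Fin n)
    (hij : ((G.degree i + G.degree j : ℕ) : ℝ) / (γ + 1) ≤
      ((G.neighborFinset i ∩ G.neighborFinset j).card : ℝ)) :
    (i ∈ S ↔ j ∈ S) := by
  have hpos : 0 < γ + 1 := by linarith
  by_contra h
  by_cases hi : i ∈ S
  · exact (hloc.card_common_neighbors_lt hpos hi (by tauto)).not_ge hij
  · have hlt := hloc.card_common_neighbors_lt hpos (i := j) (j := i) (by tauto) hi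
    rw [Finset.inter_comm, add_comm (G.degree j)] at hlt
    exact hlt.not_ge hij
end

section
/- Let G be a simple graph on Fin n with minimal degree δ ≥ 1, and let γ = 2 * n / δ (as a real number). Suppose U : Finset (Fin n) is a set of vertices such that for all distinct u, v ∈ U, |N(u) ∩ N(v)| ≤ min (deg u) (deg v) / (γ + 1), where N(x) is the neighborhood of x and deg x its degree. Then (U.card : ℝ) < γ. -/
open Finset

/-- A Bonferroni inequality, with the sum running over all ordered pairs of indices. -/
theorem three_mul_sum_card_le {ι α : Type*} [Fintype α] [DecidableEq α]
    (s : Finset ι) (A : ι → Finset α) :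
    3 * ∑ i ∈ s, (#(A i) : ℝ) ≤
      2 * Fintype.card α + ∑ i ∈ s, ∑ j ∈ s, (#(A i ∩ A j) : ℝ) := by
  have card_eq (B : Finset α) : (#B : ℝ) = ∑ x, if x ∈ B then (1 : ℝ) else 0 := by simp
  have sum_card : ∑ i ∈ s, (#(A i) : ℝ) = ∑ x, (#{i ∈ s | x ∈ A i} : ℝ) := by
    simp_rw [card_eq (A _)]
    rw [sum_comm]
    simp
  have sum_card_inter : ∑ i ∈ s, ∑ j ∈ s, (#(A i ∩ A j) : ℝ) =
      ∑ x, (#{i ∈ s | x ∈ A i} : ℝ) ^ 2 := by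
    simp_rw [card_eq (A _ ∩ A _), sum_comm (s := s) (t := univ)]
    refine sum_congr rfl fun x _ => ?_
    have h : (#{i ∈ s | x ∈ A i} : ℝ) = ∑ i ∈ s, if x ∈ A i then (1 : ℝ) else 0 := by simp
    rw [h, sq, sum_mul_sum]
    simp only [mem_inter, ite_and, ite_mul, one_mul, zero_mul]
  have pointwise (m : ℕ) : 3 * (m : ℝ) ≤ 2 + (m : ℝ) ^ 2 := by
    have h : 3 * m ≤ 2 + m ^ 2 := by
      rcases m with _ | _ | m
      · simp
      · simp
      · nlinarith
    exact_mod_cast h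
  rw [sum_card, sum_card_inter, mul_sum]
  calc _ ≤ ∑ x : α, (2 + (#{i ∈ s | x ∈ A i} : ℝ) ^ 2) := sum_le_sum fun x _ => pointwise _
    _ = _ := by simp [sum_add_distrib, mul_comm]

/-- If the pairwise intersections are small compared to the sets themselves, then
the total size of a family is bounded in terms of the size of the ambient type. -/
theorem sum_card_mul_le {ι α : Type*} [DecidableEq ι] [Fintype α] [DecidableEq α]
    (s : Finset ι) (A : ι → Finset α) {c : ℝ} (hc : 0 < c)
    (hA : ∀ i ∈ s, ∀ j ∈ s, i ≠ j →
      (#(A i ∩ A j) : ℝ) ≤ ((min #(A i) #(A j) : ℕ) : ℝ) / c) :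
    (∑ i ∈ s, (#(A i) : ℝ)) * (2 * c + 1 - #s) ≤ 2 * Fintype.card α * c := by
  have hpair : ∀ i ∈ s, ∀ j ∈ s, (#(A i ∩ A j) : ℝ) * (2 * c) ≤
      #(A i) + #(A j) + if i = j then 2 * #(A i) * (c - 1) else 0 := by
    intro i hi j hj
    split_ifs with h
    · subst h
      rw [inter_self]
      linarith
    · have hij := (le_div_iff₀ hc).1 (hA i hi j hj h)
      have hmin : 2 * ((min #(A i) #(A j) : ℕ) : ℝ) ≤ #(A i) + #(A j) := by
        exact_mod_cast (by omega : 2 * min #(A i) #(A j) ≤ #(A i) + #(A j))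
      linarith
  have hsum := sum_le_sum fun i hi => sum_le_sum (hpair i hi)
  simp only [← sum_mul, sum_add_distrib, sum_const, nsmul_eq_mul, sum_ite_eq, ← mul_sum,
    sum_ite_mem, inter_self] at hsum
  nlinarith [mul_le_mul_of_nonneg_right (three_mul_sum_card_le s A) hc.le]

theorem statement10 {n δ : ℕ} (G : SimpleGraph (Fin n)) [DecidableRel G.Adj]
    (hδ1 : 1 ≤ δ)
    (hδle : ∀ v : Fin n, δ ≤ G.degree v)
    (hδmin : ∃ v : Fin n, G.degree v = δ)
    (γ : ℝ) (hγ : γ = 2 * n / δ)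
    (U : Finset (Fin n))
    (hU : ∀ u ∈ U, ∀ v ∈ U, u ≠ v →
      ((G.neighborFinset u ∩ G.neighborFinset v).card : ℝ) ≤
        ((min (G.degree u) (G.degree v) : ℕ) : ℝ) / (γ + 1)) :
    (U.card : ℝ) < γ := by
  by_contra! hle
  have hδ : (0 : ℝ) < δ := by exact_mod_cast hδ1
  have hn : (0 : ℝ) < n := by exact_mod_cast hδmin.choose.pos
  have hγpos : 0 < γ := by rw [hγ]; positivity
  have hγδ : γ * δ = 2 * n := by rw [hγ]; field_simp
  obtain ⟨W, hWU, hW⟩ := exists_subset_card_eq (Nat.ceil_le.2 hle)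
  have hWγ : γ ≤ #W := hW ▸ Nat.le_ceil γ
  have hWlt : (#W : ℝ) < γ + 1 := hW ▸ Nat.ceil_lt_add_one hγpos.le
  have hbound := sum_card_mul_le W (fun u => G.neighborFinset u) (c := γ + 1) (by linarith)
    fun u hu v hv huv => by simpa using hU u (hWU hu) v (hWU hv) huv
  rw [Fintype.card_fin] at hbound
  have hdeg : (#W : ℝ) * δ ≤ ∑ u ∈ W, (#(G.neighborFinset u) : ℝ) := by
    rw [← nsmul_eq_mul]
    exact card_nsmul_le_sum _ _ _ fun u _ => by simpa using hδle u
  have hsum : 2 * (n : ℝ) ≤ ∑ u ∈ W, (#(G.neighborFinset u) : ℝ) := by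
    rw [← hγδ]
    exact (mul_le_mul_of_nonneg_right hWγ hδ.le).trans hdeg
  nlinarith
end

section
/- Let n ≥ 2, γ ≥ 1, and let W be a γ-stable Max-Cut instance on Fin n with W ≠ 0 and maximal cut S. Let E = {(i,j) : W i j > 0} be the support. Let D be a real diagonal matrix, set M = W + D, and let u ∈ (Fin n → ℝ), u ≠ 0, be an eigenvector of M for its least eigenvalue, i.e., M *ᵥ u = c • u for some c ∈ ℝ with c * ‖x‖² ≤ x ⬝ᵥ (M *ᵥ x) for all x. Assume u i * u j ≠ 0 for every (i,j) ∈ E, and that γ ≥ (max over (i,j) ∈ E of |u i * u j|) / (min over (i,j) ∈ E of |u i * u j|). Then the spectral partition equals the maximal cut: {i : u i > 0} = (S : Set (Fin n)) or {i : u i > 0} = (Sᶜ : Set (Fin n)). -/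
open Finset Matrix

/-- The `±1` indicator vector of the cut `T`. -/
def cutSign {n : ℕ} (T : Finset (Fin n)) (i : Fin n) : ℝ := if i ∈ T then 1 else -1

lemma cutSign_mul_self {n : ℕ} (T : Finset (Fin n)) (i : Fin n) :
    cutSign T i * cutSign T i = 1 := by
  unfold cutSign; split_ifs <;> norm_num

lemma cutWeight_eq_sum_ite {n : ℕ} (A : Matrix (Fin n) (Fin n) ℝ) (T : Finset (Fin n)) :
    cutWeight A T = ∑ i, ∑ j, if i ∈ T ∧ j ∉ T then A i j else 0 := by
  have h (i : Fin n) : (∑ j, if i ∈ T ∧ j ∉ T then A i j else 0)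
      = if i ∈ T then ∑ j ∈ Tᶜ, A i j else 0 := by
    by_cases hi : i ∈ T
    · simp only [hi, true_and, if_true, ← Finset.sum_filter]
      exact Finset.sum_congr (by ext; simp) fun _ _ => rfl
    · simp [hi]
  simp_rw [h]
  simp [cutWeight]

/-- For symmetric `A`, the quadratic form at the sign vector of a cut is an affine function of
the cut weight. -/
lemma sum_cutSign_mul {n : ℕ} {A : Matrix (Fin n) (Fin n) ℝ} (hA : A.IsSymm)
    (T : Finset (Fin n)) :
    ∑ i, ∑ j, A i j * (cutSign T i * cutSign T j) = ∑ i, ∑ j, A i j - 4 * cutWeight A T := by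
  have hswap : cutWeight A T = ∑ i, ∑ j, if j ∈ T ∧ i ∉ T then A i j else 0 := by
    rw [cutWeight_eq_sum_ite, Finset.sum_comm]
    simp_rw [hA.apply]
  have h4 : 4 * cutWeight A T = 2 * (∑ i, ∑ j, if i ∈ T ∧ j ∉ T then A i j else 0)
      + 2 * ∑ i, ∑ j, if j ∈ T ∧ i ∉ T then A i j else 0 := by
    rw [← hswap, ← cutWeight_eq_sum_ite]; ring
  rw [h4]
  simp_rw [Finset.mul_sum, ← Finset.sum_add_distrib, ← Finset.sum_sub_distrib]
  refine Finset.sum_congr rfl fun i _ => Finset.sum_congr rfl fun j _ => ?_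
  by_cases hi : i ∈ T <;> by_cases hj : j ∈ T <;> simp [cutSign, hi, hj] <;> ring

/-- If `u` minimizes the Rayleigh quotient of `M`, then its positive support is a maximal cut of
the matrix with entries `M i j * (|u i| * |u j|)`. -/
lemma isMaxCut_pos_of_least_eigenvector {n : ℕ} {M : Matrix (Fin n) (Fin n) ℝ} (hM : M.IsSymm)
    {u : Fin n → ℝ} {c : ℝ} (heig : M *ᵥ u = c • u)
    (hleast : ∀ x : Fin n → ℝ, c * (x ⬝ᵥ x) ≤ x ⬝ᵥ (M *ᵥ x)) :
    IsMaxCut (Matrix.of fun i j => M i j * (|u i| * |u j|)) {i | 0 < u i} := by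
  intro T
  set A : Matrix (Fin n) (Fin n) ℝ := Matrix.of fun i j => M i j * (|u i| * |u j|) with hA
  set P : Finset (Fin n) := {i | 0 < u i} with hP
  have hAs : A.IsSymm := by
    ext i j
    simp [hA, hM.apply i j, mul_comm |u i|]
  have hform (R : Finset (Fin n)) :
      (fun i => cutSign R i * |u i|) ⬝ᵥ (M *ᵥ fun i => cutSign R i * |u i|)
        = ∑ i, ∑ j, A i j - 4 * cutWeight A R := by
    rw [← sum_cutSign_mul hAs]
    simp only [dotProduct, mulVec, Finset.mul_sum]
    refine Finset.sum_congr rfl fun i _ => Finset.sum_congr rfl fun j _ => ?_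
    simp only [hA, Matrix.of_apply]; ring
  have hnorm (R : Finset (Fin n)) :
      (fun i => cutSign R i * |u i|) ⬝ᵥ (fun i => cutSign R i * |u i|) = u ⬝ᵥ u := by
    refine Finset.sum_congr rfl fun i _ => ?_
    rw [mul_mul_mul_comm, cutSign_mul_self, one_mul, abs_mul_abs_self]
  have hu : (fun i => cutSign P i * |u i|) = u := by
    ext i
    by_cases hi : 0 < u i
    · simp [cutSign, hP, hi, abs_of_pos hi]
    · simp [cutSign, hP, hi, abs_of_nonpos (not_lt.mp hi)]
  have hT := hleast fun i => cutSign T i * |u i|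
  have hPf := hform P
  rw [hform, hnorm] at hT
  rw [hu, heig, dotProduct_smul, smul_eq_mul] at hPf
  linarith

/-- Cut weights do not depend on diagonal entries. -/
lemma cutWeight_congr_offDiag {n : ℕ} {A B : Matrix (Fin n) (Fin n) ℝ}
    (h : ∀ i j, i ≠ j → A i j = B i j) (T : Finset (Fin n)) : cutWeight A T = cutWeight B T :=
  Finset.sum_congr rfl fun i hi => Finset.sum_congr rfl fun j hj =>
    h i j fun hij => Finset.mem_compl.mp hj (hij ▸ hi)

lemma cutWeight_smul {n : ℕ} (a : ℝ) (A : Matrix (Fin n) (Fin n) ℝ) (T : Finset (Fin n)) :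
    cutWeight (a • A) T = a * cutWeight A T := by
  simp [cutWeight, Finset.mul_sum]

theorem statement11 {n : ℕ} (hn : 2 ≤ n) (γ : ℝ) (hγ : 1 ≤ γ)
    (W : Matrix (Fin n) (Fin n) ℝ)
    (hsymm : W.IsSymm) (hnonneg : ∀ i j, 0 ≤ W i j) (hdiag : ∀ i, W i i = 0)
    (hW0 : W ≠ 0)
    (S : Finset (Fin n)) (hmax : IsMaxCut W S)
    (hstab : ∀ W', IsPerturbation γ W W' →
      ∀ T : Finset (Fin n), cutWeight W' S ≤ cutWeight W' T → T = S ∨ T = Sᶜ)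
    (D : Matrix (Fin n) (Fin n) ℝ) (hD : D.IsDiag)
    (u : Fin n → ℝ) (hu : u ≠ 0) (c : ℝ)
    (heig : (W + D) *ᵥ u = c • u)
    (hleast : ∀ x : Fin n → ℝ, c * (x ⬝ᵥ x) ≤ x ⬝ᵥ ((W + D) *ᵥ x))
    (hsupp : ∀ i j, 0 < W i j → u i * u j ≠ 0)
    (hratio : ∀ i j k l, 0 < W i j → 0 < W k l → |u i * u j| ≤ γ * |u k * u l|) :
    {i : Fin n | 0 < u i} = (S : Set (Fin n)) ∨
    {i : Fin n | 0 < u i} = ((Sᶜ : Finset (Fin n)) : Set (Fin n)) := by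
  obtain ⟨k, l, hkl, hmin⟩ : ∃ k l, 0 < W k l ∧
      ∀ i j, 0 < W i j → |u k * u l| ≤ |u i * u j| := by
    obtain ⟨a, b, hab⟩ : ∃ a b, W a b ≠ 0 := by
      by_contra! h
      exact hW0 (Matrix.ext h)
    obtain ⟨p, hp, hpmin⟩ := Finset.exists_min_image
      ({p | 0 < W p.1 p.2} : Finset (Fin n × Fin n)) (fun p => |u p.1 * u p.2|)
      ⟨(a, b), by simpa using (hnonneg a b).lt_of_ne' hab⟩
    exact ⟨p.1, p.2, by simpa using hp, fun i j hij => hpmin (i, j) (by simpa using hij)⟩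
  have hm : 0 < |u k * u l| := abs_pos.mpr (hsupp k l hkl)
  set m := |u k * u l|
  have hpert : IsPerturbation γ W (m⁻¹ • Matrix.of fun i j => W i j * (|u i| * |u j|)) := by
    refine ⟨?_, fun i j => ?_⟩
    · ext i j
      simp [hsymm.apply i j, mul_comm |u i|]
    · rcases (hnonneg i j).eq_or_lt with h | h
      · simp [← h]
      · have h1 : 1 ≤ m⁻¹ * |u i * u j| := by
          rw [inv_mul_eq_div, one_le_div hm]; exact hmin i j h
        have h2 : m⁻¹ * |u i * u j| ≤ γ := by
          rw [inv_mul_eq_div, div_le_iff₀ hm]; exact hratio i j k l h hkl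
        rw [Matrix.smul_apply, Matrix.of_apply, smul_eq_mul, ← abs_mul, mul_left_comm]
        exact ⟨le_mul_of_one_le_right h.le h1, by
          rw [mul_comm γ]; exact mul_le_mul_of_nonneg_left h2 h.le⟩
  have hcut := isMaxCut_pos_of_least_eigenvector (hsymm.add hD.isSymm) heig hleast S
  have hoff (T : Finset (Fin n)) :=
    cutWeight_congr_offDiag (A := Matrix.of fun i j => (W + D) i j * (|u i| * |u j|))
      (B := Matrix.of fun i j => W i j * (|u i| * |u j|))
      (fun i j hij => by simp [hD hij]) T
  rw [hoff, hoff] at hcut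
  have hST := hstab _ hpert {i | 0 < u i} (by
    rw [cutWeight_smul, cutWeight_smul]
    exact mul_le_mul_of_nonneg_left hcut (inv_nonneg.mpr hm.le))
  refine hST.imp (fun h => ?_) (fun h => ?_) <;> simp [← h]
end

section
/- Let G be a simple graph on Fin n, let S : Finset (Fin n), and let k > 0. Suppose the cut (S, Sᶜ) is k-distinct: for every T : Finset (Fin n), e(S) − e(T) ≥ k * min (|S Δ T|) (|S Δ Tᶜ|), where e(X) denotes the number of edges of G with exactly one endpoint in X and Δ denotes symmetric difference. Then for every nonempty U : Finset (Fin n) with 2 * |U| ≤ n, the number of edges of G with exactly one endpoint in U is at least k * |U|; in particular the Cheeger constant of G is at least k. -/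
open Finset

/-- Number of edges of `G` with exactly one endpoint in `X`. -/
def edgeCut {n : ℕ} (G : SimpleGraph (Fin n)) [DecidableRel G.Adj] (X : Finset (Fin n)) : ℕ :=
  ∑ u ∈ X, ∑ v ∈ Xᶜ, if G.Adj u v then 1 else 0

/-- Counting ordered pairs, every edge of the cut is seen twice. -/
theorem two_mul_edgeCut {n : ℕ} (G : SimpleGraph (Fin n)) [DecidableRel G.Adj]
    (X : Finset (Fin n)) :
    2 * edgeCut G X = ∑ u, ∑ v, if G.Adj u v ∧ ¬(u ∈ X ↔ v ∈ X) then 1 else 0 := by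
  have key : edgeCut G X = ∑ u, ∑ v, if G.Adj u v ∧ u ∈ X ∧ v ∉ X then 1 else 0 := by
    unfold edgeCut
    rw [← Finset.sum_filter_add_sum_filter_not univ (· ∈ X)]
    rw [Finset.sum_eq_zero (s := univ.filter (¬ · ∈ X))]
    · rw [add_zero, Finset.filter_mem_eq_inter, Finset.univ_inter]
      refine Finset.sum_congr rfl fun u hu => ?_
      rw [← Finset.sum_filter_add_sum_filter_not univ (· ∈ X),
        Finset.sum_eq_zero (s := univ.filter (· ∈ X)), zero_add]
      · refine Finset.sum_congr (by ext; simp) fun v hv => ?_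
        simp_all
      · simp_all
    · simp_all
  have key' : edgeCut G X = ∑ u, ∑ v, if G.Adj u v ∧ v ∈ X ∧ u ∉ X then 1 else 0 := by
    rw [key, Finset.sum_comm]
    simp only [G.adj_comm]
  rw [two_mul]
  nth_rewrite 1 [key]
  rw [key', ← Finset.sum_add_distrib]
  refine Finset.sum_congr rfl fun u _ => ?_
  rw [← Finset.sum_add_distrib]
  refine Finset.sum_congr rfl fun v _ => ?_
  by_cases hu : u ∈ X <;> by_cases hv : v ∈ X <;> simp [hu, hv]

/-- The cut function is subadditive under symmetric difference. -/
theorem edgeCut_symmDiff_le {n : ℕ} (G : SimpleGraph (Fin n)) [DecidableRel G.Adj]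
    (A B : Finset (Fin n)) :
    edgeCut G (symmDiff A B) ≤ edgeCut G A + edgeCut G B := by
  refine Nat.le_of_mul_le_mul_left (c := 2) ?_ two_pos
  rw [mul_add, two_mul_edgeCut, two_mul_edgeCut, two_mul_edgeCut, ← Finset.sum_add_distrib]
  refine Finset.sum_le_sum fun u _ => ?_
  rw [← Finset.sum_add_distrib]
  refine Finset.sum_le_sum fun v _ => ?_
  simp only [Finset.mem_symmDiff]
  by_cases h : G.Adj u v <;> by_cases u ∈ A <;> by_cases v ∈ A <;> by_cases u ∈ B <;>
    by_cases v ∈ B <;> simp [*]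

theorem statement17 {n : ℕ} (G : SimpleGraph (Fin n)) [DecidableRel G.Adj]
    (S : Finset (Fin n)) (k : ℝ) (hk : 0 < k)
    (hdist : ∀ T : Finset (Fin n),
      k * ((min (symmDiff S T).card (symmDiff S Tᶜ).card : ℕ) : ℝ) ≤
        (edgeCut G S : ℝ) - (edgeCut G T : ℝ)) :
    (∀ U : Finset (Fin n), U.Nonempty → 2 * U.card ≤ n →
      k * (U.card : ℝ) ≤ (edgeCut G U : ℝ)) ∧
    (∀ U : Finset (Fin n), U.Nonempty → 2 * U.card ≤ n →
      k ≤ (edgeCut G U : ℝ) / (U.card : ℝ)) := by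
  have main : ∀ U : Finset (Fin n), 2 * U.card ≤ n → k * (U.card : ℝ) ≤ (edgeCut G U : ℝ) := by
    intro U hU
    have h := hdist (symmDiff S U)
    have hcompl : symmDiff S (symmDiff S U)ᶜ = Uᶜ := by
      ext x
      simp only [Finset.mem_symmDiff, Finset.mem_compl]
      tauto
    have hcard : Uᶜ.card = n - U.card := by simp [Finset.card_compl]
    rw [symmDiff_symmDiff_cancel_left, hcompl, min_eq_left (by omega)] at h
    have hsub := edgeCut_symmDiff_le G (symmDiff S U) U
    rw [symmDiff_symmDiff_cancel_right] at hsub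
    have hsub' : (edgeCut G S : ℝ) ≤ edgeCut G (symmDiff S U) + edgeCut G U := by
      exact_mod_cast hsub
    linarith
  refine ⟨fun U _ hU => main U hU, fun U hne hU => ?_⟩
  rw [le_div_iff₀ (by exact_mod_cast hne.card_pos)]
  exact main U hU
end

section
/- Let W be a Max-Cut instance on Fin n with maximal cut S, and suppose W is γ-locally stable with respect to S for some γ ≥ 1, with S ≠ ∅ or W = 0 excluded (assume W ≠ 0). Then the maximal cut carries more than a γ/(γ+1) fraction of the total edge weight: w(S) > (γ/(γ + 1)) * (1/2) * ∑_i ∑_j W i j. -/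
open Finset Matrix

/-- Summing a strict inequality at every vertex of `T` between its weight to `T` (scaled by `γ`)
and its weight to `U`. -/
theorem mul_sum_sum_lt_of_forall_lt {ι : Type*} {W : Matrix ι ι ℝ} {γ : ℝ} {T U : Finset ι}
    (h : ∀ v ∈ T, γ * ∑ u ∈ T, W u v < ∑ u ∈ U, W u v) (hT : T.Nonempty) :
    γ * ∑ v ∈ T, ∑ u ∈ T, W u v < ∑ v ∈ T, ∑ u ∈ U, W u v := by
  rw [mul_sum]
  exact sum_lt_sum_of_nonempty hT h

theorem mul_sum_sum_le_of_forall_lt {ι : Type*} {W : Matrix ι ι ℝ} {γ : ℝ} {T U : Finset ι}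
    (h : ∀ v ∈ T, γ * ∑ u ∈ T, W u v < ∑ u ∈ U, W u v) :
    γ * ∑ v ∈ T, ∑ u ∈ T, W u v ≤ ∑ v ∈ T, ∑ u ∈ U, W u v := by
  rw [mul_sum]
  exact sum_le_sum fun v hv => (h v hv).le

theorem cutWeight_eq_sum_compl {n : ℕ} (W : Matrix (Fin n) (Fin n) ℝ) (S : Finset (Fin n)) :
    cutWeight W S = ∑ v ∈ Sᶜ, ∑ u ∈ S, W u v :=
  sum_comm

theorem cutWeight_eq_sum_of_isSymm {n : ℕ} {W : Matrix (Fin n) (Fin n) ℝ} (hW : W.IsSymm)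
    (S : Finset (Fin n)) : cutWeight W S = ∑ v ∈ S, ∑ u ∈ Sᶜ, W u v :=
  sum_congr rfl fun i _ => sum_congr rfl fun j _ => hW.apply j i

/-- The total weight splits into the weight inside `S`, inside `Sᶜ`, and twice the cut. -/
theorem sum_sum_eq_add_two_mul_cutWeight {n : ℕ} {W : Matrix (Fin n) (Fin n) ℝ} (hW : W.IsSymm)
    (S : Finset (Fin n)) :
    ∑ i, ∑ j, W i j =
      ∑ v ∈ S, ∑ u ∈ S, W u v + ∑ v ∈ Sᶜ, ∑ u ∈ Sᶜ, W u v + 2 * cutWeight W S := by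
  have split (v : Fin n) : ∑ u, W v u = ∑ u ∈ S, W u v + ∑ u ∈ Sᶜ, W u v := by
    rw [sum_add_sum_compl]
    exact sum_congr rfl fun u _ => hW.apply u v
  simp only [split]
  rw [← sum_add_sum_compl S, sum_add_distrib, sum_add_distrib, ← cutWeight_eq_sum_compl,
    ← cutWeight_eq_sum_of_isSymm hW]
  ring

theorem statement18 {n : ℕ}
    (W : Matrix (Fin n) (Fin n) ℝ)
    (hsymm : W.IsSymm) (hnonneg : ∀ i j, 0 ≤ W i j) (hdiag : ∀ i, W i i = 0)
    (hW0 : W ≠ 0)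
    (γ : ℝ) (hγ : 1 ≤ γ)
    (S : Finset (Fin n)) (hmax : IsMaxCut W S)
    (hloc : IsLocallyStable γ W S) :
    (γ / (γ + 1)) * ((1 / 2 : ℝ) * ∑ i, ∑ j, W i j) < cutWeight W S := by
  have h₁ := cutWeight_eq_sum_of_isSymm hsymm S
  have h₂ := cutWeight_eq_sum_compl W S
  have key : γ * (∑ v ∈ S, ∑ u ∈ S, W u v + ∑ v ∈ Sᶜ, ∑ u ∈ Sᶜ, W u v) < 2 * cutWeight W S := by
    rw [mul_add]
    rcases S.eq_empty_or_nonempty with hS | hS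
    · have hn : Sᶜ.Nonempty := by
        obtain ⟨i, -⟩ := Function.ne_iff.mp hW0
        exact ⟨i, by simp [hS]⟩
      linarith [mul_sum_sum_le_of_forall_lt hloc.1, mul_sum_sum_lt_of_forall_lt hloc.2 hn]
    · linarith [mul_sum_sum_lt_of_forall_lt hloc.1 hS, mul_sum_sum_le_of_forall_lt hloc.2]
  rw [sum_sum_eq_add_two_mul_cutWeight hsymm S, div_mul_eq_mul_div, div_lt_iff₀ (by linarith)]
  linarith
end
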